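/- Let K be a field of characteristic zero, A a 2-dimensional K-vector space, and B, C K-vector spaces of dimensions b, c ≥ r. Then σ_r(PA* × PB* × PC*) = P(Sub_{2,r,r}); in particular, when b = c = r, σ_r(P^1 × P^{r-1} × P^{r-1}) = P(K^2 ⊗ K^r ⊗ K^r), i.e., the Zariski closure of the set of tensors of rank at most r in K^2 ⊗ K^r ⊗ K^r is the whole space. -/

import Mathlib

/-!
Statement 16: for `dim A = 2` and `dim B = b ≥ r`, `dim C = c ≥ r`, one has
`σ_r(PA* × PB* × PC*) = P(Sub_{2,r,r})`: the Zariski closure of the set of tensors of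
rank at most `r` equals the subspace variety `Sub_{2,r,r}`.  In particular, when
`b = c = r`, the closure of the set of tensors of rank at most `r` in `K² ⊗ K^r ⊗ K^r`
is the whole space.
-/

open MvPolynomial

/-- `T` is a sum of at most `r` decomposable tensors in `A* ⊗ B* ⊗ C*`. -/
def RankLE {K : Type} [Field K] {a b c : ℕ} (r : ℕ) (T : Fin a × Fin b × Fin c → K) :
    Prop :=
  ∃ (u : Fin r → Fin a → K) (v : Fin r → Fin b → K) (w : Fin r → Fin c → K),
    ∀ x, T x = ∑ i, u i x.1 * v i x.2.1 * w i x.2.2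

/-- The homogeneous ideal of (the affine cone over) `σ_r(PA* × PB* × PC*)`. -/
noncomputable def secantIdeal (K : Type) [Field K] (a b c r : ℕ) :
    Ideal (MvPolynomial (Fin a × Fin b × Fin c) K) :=
  ⨅ (T : Fin a × Fin b × Fin c → K) (_ : RankLE r T),
    RingHom.ker (MvPolynomial.eval T)

/-- The affine cone over `σ_r`: the Zariski closure of the set of tensors of rank at
most `r`, i.e. the zero locus of its vanishing ideal. -/
noncomputable def secantCone (K : Type) [Field K] (a b c r : ℕ) :
    Set (Fin a × Fin b × Fin c → K) :=
  { T | ∀ f ∈ secantIdeal K a b c r, MvPolynomial.eval T f = 0 }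

/-- The subspace variety `Sub_{a,r,r} ⊂ A* ⊗ B* ⊗ C*`: tensors lying in
`A* ⊗ B'* ⊗ C'*` for some subspaces of dimensions `r`. -/
def subspaceVariety (K : Type) [Field K] (a b c r : ℕ) :
    Set (Fin a × Fin b × Fin c → K) :=
  { T | ∃ (B' : Submodule K (Fin b → K)) (C' : Submodule K (Fin c → K)),
      Module.finrank K B' = r ∧ Module.finrank K C' = r ∧
      (∀ (i : Fin a) (k : Fin c), (fun j => T (i, j, k)) ∈ B') ∧
      (∀ (i : Fin a) (j : Fin b), (fun k => T (i, j, k)) ∈ C') }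

section LinearAlgebra

variable {K : Type*} [Field K]

/-- A subspace of dimension at most `r` is contained in a subspace of dimension `r`. -/
theorem exists_le_finrank_eq {V : Type*} [AddCommGroup V] [Module K V] [Module.Finite K V]
    (W : Submodule K V) {r : ℕ} (hW : Module.finrank K W ≤ r) (hr : r ≤ Module.finrank K V) :
    ∃ W' : Submodule K V, W ≤ W' ∧ Module.finrank K W' = r := by
  induction r, hW using Nat.le_induction with
  | base => exact ⟨W, le_rfl, rfl⟩
  | succ s hs ih =>
    obtain ⟨U, hWU, hU⟩ := ih (by omega)
    obtain ⟨x, hx⟩ : ∃ x, x ∉ U := by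
      by_contra! h
      rw [(Submodule.eq_top_iff'.2 h), finrank_top] at hU
      omega
    refine ⟨U ⊔ Submodule.span K {x}, hWU.trans le_sup_left, ?_⟩
    rw [Submodule.finrank_sup_span_singleton hx, hU]

/-- A matrix of rank at least `s` can be compressed to the `s × s` identity matrix. -/
theorem Matrix.exists_mul_mul_eq_one {m n : Type*} [Fintype m] [Fintype n] [DecidableEq m]
    [DecidableEq n] (A : Matrix m n K) {s : ℕ} (hs : s ≤ A.rank) :
    ∃ (L : Matrix (Fin s) m K) (R : Matrix n (Fin s) K), L * A * R = 1 := by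
  obtain ⟨f, hf⟩ := exists_linearIndependent_of_le_finrank hs
  choose g hg using fun i => (f i).2
  have hli : LinearIndependent K fun i => A.mulVecLin (g i) := by
    simp only [hg]
    exact hf.map' (LinearMap.range A.mulVecLin).subtype (Submodule.ker_subtype _)
  let R : Matrix n (Fin s) K := Matrix.of fun j i => g i j
  have hker : LinearMap.ker (A * R).mulVecLin = ⊥ := by
    rw [LinearMap.ker_eq_bot, Matrix.coe_mulVecLin, Matrix.mulVec_injective_iff]
    exact hli
  obtain ⟨P, hP⟩ := (A * R).mulVecLin.exists_leftInverse_of_injective hker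
  refine ⟨LinearMap.toMatrix' P, R, ?_⟩
  have := congrArg LinearMap.toMatrix' hP
  rwa [LinearMap.toMatrix'_comp, ← Matrix.toLin'_apply', LinearMap.toMatrix'_toLin',
    LinearMap.toMatrix'_id, ← Matrix.mul_assoc] at this

/-- A subspace of dimension `r` is the image of an idempotent factoring through `K ^ r`. -/
theorem Submodule.exists_mul_mulVec_eq_self {m : Type*} [Fintype m] [DecidableEq m] {r : ℕ}
    (W : Submodule K (m → K)) (hW : Module.finrank K W = r) :
    ∃ (E : Matrix m (Fin r) K) (F : Matrix (Fin r) m K), ∀ v ∈ W, E.mulVec (F.mulVec v) = v := by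
  obtain ⟨P, hP⟩ := W.subtype.exists_leftInverse_of_injective W.ker_subtype
  let e : (Fin r → K) ≃ₗ[K] W := LinearEquiv.ofFinrankEq _ _ (by simp [hW])
  refine ⟨LinearMap.toMatrix' (W.subtype ∘ₗ e.toLinearMap),
    LinearMap.toMatrix' (e.symm.toLinearMap ∘ₗ P), fun v hv => ?_⟩
  have h : P v = ⟨v, hv⟩ := LinearMap.congr_fun hP ⟨v, hv⟩
  simp [LinearMap.toMatrix'_mulVec, h]

end LinearAlgebra

section Generic

variable {L : Type} [Field L]

/-- A matrix with separable characteristic polynomial is diagonalizable. -/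
theorem Matrix.exists_eq_mul_diagonal_mul_of_separable_charpoly [IsAlgClosed L] {r : ℕ}
    (M : Matrix (Fin r) (Fin r) L) (hM : M.charpoly.Separable) :
    ∃ (P : Matrix (Fin r) (Fin r) L) (d : Fin r → L),
      P * P⁻¹ = 1 ∧ M = P * Matrix.diagonal d * P⁻¹ := by
  classical
  have hcard : M.charpoly.roots.toFinset.card = r := by
    rw [Multiset.toFinset_card_of_nodup (Polynomial.nodup_roots hM),
      ← (IsAlgClosed.splits M.charpoly).natDegree_eq_card_roots]
    simp
  let e := M.charpoly.roots.toFinset.equivFinOfCardEq hcard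
  let d : Fin r → L := fun i => (e.symm i : L)
  have hd : Function.Injective d := Subtype.val_injective.comp e.symm.injective
  have hev : ∀ i, Module.End.HasEigenvalue (Matrix.toLin' M) (d i) := by
    intro i
    rw [Module.End.hasEigenvalue_iff_mem_spectrum, Matrix.spectrum_toLin',
      Matrix.mem_spectrum_iff_isRoot_charpoly]
    have := (e.symm i).2
    rw [Multiset.mem_toFinset] at this
    exact Polynomial.isRoot_of_mem_roots this
  choose v hv using fun i => (hev i).exists_hasEigenvector
  have hli := Module.End.eigenvectors_linearIndependent' _ d hd v hv
  let P : Matrix (Fin r) (Fin r) L := Matrix.of fun j i => v i j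
  have hPu : IsUnit P := by
    rw [← Matrix.linearIndependent_cols_iff_isUnit]
    exact hli
  have hPP : P * P⁻¹ = 1 := Matrix.mul_nonsing_inv _ ((Matrix.isUnit_iff_isUnit_det _).1 hPu)
  refine ⟨P, d, hPP, ?_⟩
  have hMP : M * P = P * Matrix.diagonal d := by
    ext j i
    rw [Matrix.mul_diagonal]
    have := congrFun (hv i).apply_eq_smul j
    simpa [Matrix.toLin'_apply, Matrix.mulVec, dotProduct, Matrix.mul_apply, P, mul_comm] using this
  rw [← hMP, Matrix.mul_assoc, hPP, Matrix.mul_one]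

/-- The `i`-th slice of a tensor, as a matrix. -/
def tensorSlice {R : Type*} {a b c : ℕ} (T : Fin a × Fin b × Fin c → R) (i : Fin a) :
    Matrix (Fin b) (Fin c) R :=
  Matrix.of fun j k => T (i, j, k)

theorem rankLE_of_slices_eq {a b c r : ℕ} {T : Fin a × Fin b × Fin c → L}
    (P : Matrix (Fin b) (Fin r) L) (Q : Matrix (Fin r) (Fin c) L) (d : Fin a → Fin r → L)
    (h : ∀ i, tensorSlice T i = P * Matrix.diagonal (d i) * Q) : RankLE r T := by
  refine ⟨fun p i => d i p, fun p j => P j p, fun p k => Q p k, fun ⟨i, j, k⟩ => ?_⟩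
  have := congrFun (congrFun (h i) j) k
  rw [Matrix.mul_apply] at this
  simp only [tensorSlice, Matrix.of_apply, Matrix.mul_diagonal] at this
  rw [this]
  exact Finset.sum_congr rfl fun p _ => by ring

theorem Matrix.separable_charpoly_iff_resultant_ne_zero [CharZero L] {r : ℕ}
    (M : Matrix (Fin r) (Fin r) L) : M.charpoly.Separable ↔
      Polynomial.resultant M.charpoly M.charpoly.derivative r (r - 1) ≠ 0 := by
  have h1 : M.charpoly.natDegree = r := by simp
  have h2 : M.charpoly.derivative.natDegree = r - 1 := by
    rw [Polynomial.natDegree_derivative, h1]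
  have := Polynomial.isUnit_resultant_iff_isCoprime (g := M.charpoly.derivative) M.charpoly_monic
  rw [h1, h2, isUnit_iff_ne_zero] at this
  exact this.symm

/-- A polynomial in the entries of a `2 × r × r` tensor whose nonvanishing forces the two slices
to be simultaneously equivalent to diagonal matrices. -/
noncomputable def pencilDiscr {R : Type*} [CommRing R] {r : ℕ} (T : Fin 2 × Fin r × Fin r → R) :
    R :=
  let p := ((tensorSlice T 0).adjugate * tensorSlice T 1).charpoly
  (tensorSlice T 0).det * Polynomial.resultant p p.derivative r (r - 1)

theorem map_pencilDiscr {R S : Type*} [CommRing R] [CommRing S] (φ : R →+* S) {r : ℕ}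
    (T : Fin 2 × Fin r × Fin r → R) : φ (pencilDiscr T) = pencilDiscr (φ ∘ T) := by
  have h : ∀ i, tensorSlice (φ ∘ T) i = φ.mapMatrix (tensorSlice T i) := fun i => rfl
  rw [pencilDiscr, pencilDiscr, h, h, ← RingHom.map_adjugate, ← map_mul φ.mapMatrix,
    RingHom.mapMatrix_apply φ (_ * _), Matrix.charpoly_map, Polynomial.derivative_map,
    Polynomial.resultant_map_map, map_mul, RingHom.map_det]

theorem rankLE_of_pencilDiscr_ne_zero [IsAlgClosed L] [CharZero L] {r : ℕ}
    {T : Fin 2 × Fin r × Fin r → L} (hT : pencilDiscr T ≠ 0) : RankLE r T := by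
  obtain ⟨hdet, hres⟩ := mul_ne_zero_iff.1 hT
  set X := tensorSlice T 0 with hX
  set Y := tensorSlice T 1 with hY
  obtain ⟨P, d, hP, hM⟩ := Matrix.exists_eq_mul_diagonal_mul_of_separable_charpoly _
    ((Matrix.separable_charpoly_iff_resultant_ne_zero _).2 hres)
  refine rankLE_of_slices_eq (X * P) P⁻¹ ![1, X.det⁻¹ • d] fun i => ?_
  fin_cases i
  · simp [Matrix.mul_assoc, hP, ← hX]
  · have : X * (X.adjugate * Y) = X.det • Y := by
      rw [← Matrix.mul_assoc, Matrix.mul_adjugate, Matrix.smul_mul, Matrix.one_mul]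
    rw [hM] at this
    simp [← hY, Matrix.mul_assoc] at this ⊢
    rw [this, smul_smul, inv_mul_cancel₀ hdet, one_smul]

theorem exists_pencilDiscr_ne_zero [CharZero L] (r : ℕ) :
    ∃ T : Fin 2 × Fin r × Fin r → L, pencilDiscr T ≠ 0 := by
  let D : Matrix (Fin r) (Fin r) L := Matrix.diagonal fun i => ((i : ℕ) : L)
  let T : Fin 2 × Fin r × Fin r → L := fun x =>
    if x.1 = 0 then (1 : Matrix (Fin r) (Fin r) L) x.2.1 x.2.2 else D x.2.1 x.2.2
  have h0 : tensorSlice T 0 = 1 := by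
    ext j k
    simp [tensorSlice, T]
  have h1 : tensorSlice T 1 = D := by
    ext j k
    simp [tensorSlice, T]
  refine ⟨T, ?_⟩
  rw [pencilDiscr, h0, h1, Matrix.adjugate_one, one_mul, Matrix.det_one, one_mul]
  rw [← Matrix.separable_charpoly_iff_resultant_ne_zero, Matrix.charpoly_diagonal]
  exact Polynomial.separable_prod_X_sub_C_iff.2 (Nat.cast_injective.comp Fin.val_injective)

theorem eq_zero_of_eval_rankLE_eq_zero_of_isAlgClosed [IsAlgClosed L] [CharZero L] {r : ℕ}
    (f : MvPolynomial (Fin 2 × Fin r × Fin r) L)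
    (hf : ∀ T, RankLE r T → MvPolynomial.eval T f = 0) : f = 0 := by
  let G : MvPolynomial (Fin 2 × Fin r × Fin r) L := pencilDiscr MvPolynomial.X
  have hG : ∀ T, MvPolynomial.eval T G = pencilDiscr T := fun T => by
    rw [map_pencilDiscr]
    congr 1
    ext x
    simp
  have hG0 : G ≠ 0 := by
    obtain ⟨T, hT⟩ := exists_pencilDiscr_ne_zero (L := L) r
    intro h
    exact hT (by rw [← hG, h, map_zero])
  refine (mul_eq_zero.1 (MvPolynomial.funext fun T => ?_ : f * G = 0)).resolve_right hG0
  rw [map_mul, map_zero, hG]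
  by_cases hT : pencilDiscr T = 0
  · rw [hT, mul_zero]
  · rw [hf T (rankLE_of_pencilDiscr_ne_zero hT), zero_mul]

end Generic

section Descent

variable {K : Type} [Field K]

theorem aeval_eq_zero_of_rankLE [Infinite K] {L : Type} [Field L] [Algebra K L] {a b c r : ℕ}
    (f : MvPolynomial (Fin a × Fin b × Fin c) K)
    (hf : ∀ T, RankLE r T → MvPolynomial.eval T f = 0) {T : Fin a × Fin b × Fin c → L}
    (hT : RankLE r T) : MvPolynomial.aeval T f = 0 := by
  obtain ⟨u, v, w, hT⟩ := hT
  let σ := (Fin r × Fin a) ⊕ (Fin r × Fin b) ⊕ (Fin r × Fin c)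
  let φ : Fin a × Fin b × Fin c → MvPolynomial σ K := fun x =>
    ∑ i, X (.inl (i, x.1)) * X (.inr (.inl (i, x.2.1))) * X (.inr (.inr (i, x.2.2)))
  have h0 : MvPolynomial.bind₁ φ f = 0 := by
    refine MvPolynomial.funext fun y => ?_
    rw [map_zero, ← MvPolynomial.aeval_eq_eval, MvPolynomial.aeval_bind₁,
      MvPolynomial.aeval_eq_eval]
    exact hf _ ⟨fun i j => y (.inl (i, j)), fun i j => y (.inr (.inl (i, j))),
      fun i j => y (.inr (.inr (i, j))), fun x => by simp [φ]⟩
  let y : σ → L := Sum.elim (fun p => u p.1 p.2)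
    (Sum.elim (fun p => v p.1 p.2) (fun p => w p.1 p.2))
  have h1 := congrArg (MvPolynomial.aeval y) h0
  rw [MvPolynomial.aeval_bind₁, map_zero] at h1
  rw [← h1]
  congr 2
  ext x
  simp [φ, y, hT]

/-- Tensors of rank at most `r` are Zariski dense in `K² ⊗ K^r ⊗ K^r`. -/
theorem eq_zero_of_eval_rankLE_eq_zero [CharZero K] {r : ℕ}
    (f : MvPolynomial (Fin 2 × Fin r × Fin r) K)
    (hf : ∀ T, RankLE r T → MvPolynomial.eval T f = 0) : f = 0 := by
  have : CharZero (AlgebraicClosure K) := charZero_of_injective_algebraMap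
    (algebraMap K (AlgebraicClosure K)).injective
  refine MvPolynomial.map_injective _ (algebraMap K (AlgebraicClosure K)).injective ?_
  rw [map_zero]
  refine eq_zero_of_eval_rankLE_eq_zero_of_isAlgClosed _ fun T hT => ?_
  rw [MvPolynomial.eval_map, ← MvPolynomial.aeval_def]
  exact aeval_eq_zero_of_rankLE f hf hT

end Descent

section Secant

variable {K : Type} [Field K] {a b c r : ℕ}

theorem mem_secantIdeal_iff {f : MvPolynomial (Fin a × Fin b × Fin c) K} :
    f ∈ secantIdeal K a b c r ↔ ∀ T, RankLE r T → MvPolynomial.eval T f = 0 := by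
  simp [secantIdeal, RingHom.mem_ker]

/-- If a matrix of coordinates has rank at most `r` on all tensors of rank at most `r`, then it
has rank at most `r` on the secant cone. -/
theorem rank_le_of_mem_secantCone {m n : Type*} [Fintype m] [Fintype n] [DecidableEq m]
    [DecidableEq n] (g : m → n → Fin a × Fin b × Fin c)
    (hg : ∀ T : Fin a × Fin b × Fin c → K, RankLE r T →
      (Matrix.of fun x y => T (g x y)).rank ≤ r)
    {T : Fin a × Fin b × Fin c → K} (hT : T ∈ secantCone K a b c r) :
    (Matrix.of fun x y => T (g x y)).rank ≤ r := by
  by_contra! h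
  obtain ⟨P, Q, hPQ⟩ := Matrix.exists_mul_mul_eq_one _ (Nat.succ_le_of_lt h)
  let A : Matrix m n (MvPolynomial (Fin a × Fin b × Fin c) K) := Matrix.of fun x y => X (g x y)
  let P' : Matrix _ m (MvPolynomial (Fin a × Fin b × Fin c) K) := P.map C
  let Q' : Matrix n _ (MvPolynomial (Fin a × Fin b × Fin c) K) := Q.map C
  let f : MvPolynomial (Fin a × Fin b × Fin c) K := (P' * A * Q').det
  have hf : ∀ S, MvPolynomial.eval S f = (P * (Matrix.of fun x y => S (g x y)) * Q).det := by
    intro S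
    rw [RingHom.map_det, RingHom.mapMatrix_apply, Matrix.map_mul, Matrix.map_mul]
    congr 3 <;> ext <;> simp [A, P', Q']
  have hmem : f ∈ secantIdeal K a b c r := by
    rw [mem_secantIdeal_iff]
    intro S hS
    rw [hf]
    by_contra hdet
    have h1 := Matrix.rank_of_isUnit _
      ((Matrix.isUnit_iff_isUnit_det _).2 (isUnit_iff_ne_zero.2 hdet))
    have h2 := (Matrix.rank_mul_le_left (P * (Matrix.of fun x y => S (g x y))) Q).trans
      (Matrix.rank_mul_le_right _ _)
    have h3 := hg S hS
    rw [Fintype.card_fin] at h1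
    omega
  have := hT f hmem
  rw [hf, hPQ, Matrix.det_one] at this
  exact one_ne_zero this

theorem rank_le_of_eq_sum {m n : Type*} [Fintype m] [Fintype n] (A : Matrix m n K)
    (v : Fin r → m → K) (w : Fin r → n → K) (h : ∀ x y, A x y = ∑ i, v i x * w i y) :
    A.rank ≤ r := by
  have : A = (Matrix.of fun x i => v i x) * (Matrix.of w) := by
    ext x y
    simp [h, Matrix.mul_apply]
  rw [this]
  exact (Matrix.rank_mul_le_left _ _).trans ((Matrix.rank_le_card_width _).trans (by simp))

theorem exists_submodule_of_rank_le {m : ℕ} {n : Type*} [Fintype n]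
    (A : Matrix (Fin m) n K) (hA : A.rank ≤ r) (hr : r ≤ m) :
    ∃ W : Submodule K (Fin m → K), Module.finrank K W = r ∧ ∀ y, (fun x => A x y) ∈ W := by
  rw [Matrix.rank_eq_finrank_span_cols] at hA
  obtain ⟨W, hle, hW⟩ := exists_le_finrank_eq _ hA (by simpa using hr)
  exact ⟨W, hW, fun y => hle (Submodule.subset_span ⟨y, rfl⟩)⟩

theorem secantCone_subset_subspaceVariety (hb : r ≤ b) (hc : r ≤ c) :
    secantCone K a b c r ⊆ subspaceVariety K a b c r := by
  intro T hT
  obtain ⟨B', hB, hB'⟩ := exists_submodule_of_rank_le _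
    (rank_le_of_mem_secantCone (fun (j : Fin b) (p : Fin a × Fin c) => (p.1, j, p.2))
      (fun S ⟨u, v, w, hS⟩ => rank_le_of_eq_sum _ v (fun i p => u i p.1 * w i p.2)
        fun x y => by simp [hS, mul_left_comm, mul_assoc]) hT) hb
  obtain ⟨C', hC, hC'⟩ := exists_submodule_of_rank_le _
    (rank_le_of_mem_secantCone (fun (k : Fin c) (p : Fin a × Fin b) => (p.1, p.2, k))
      (fun S ⟨u, v, w, hS⟩ => rank_le_of_eq_sum _ w (fun i p => u i p.1 * v i p.2)
        fun x y => by simp [hS, mul_comm]) hT) hc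
  exact ⟨B', C', hB, hC, fun i k => hB' (i, k), fun i j => hC' (i, j)⟩

/-- The action of a pair of matrices on the last two factors of a tensor. -/
def tensorTransform {R : Type*} [CommSemiring R] {a b c r s : ℕ} (E : Matrix (Fin b) (Fin r) R)
    (F : Matrix (Fin c) (Fin s) R) (S : Fin a × Fin r × Fin s → R) : Fin a × Fin b × Fin c → R :=
  fun x => ∑ p, ∑ q, E x.2.1 p * F x.2.2 q * S (x.1, p, q)

theorem RankLE.tensorTransform {s t : ℕ} (E : Matrix (Fin b) (Fin s) K)
    (F : Matrix (Fin c) (Fin t) K) {S : Fin a × Fin s × Fin t → K} (hS : RankLE r S) :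
    RankLE r (tensorTransform E F S) := by
  obtain ⟨u, v, w, hS⟩ := hS
  refine ⟨u, fun i => E.mulVec (v i), fun i => F.mulVec (w i), fun x => ?_⟩
  simp only [_root_.tensorTransform, hS, Matrix.mulVec, dotProduct, Finset.mul_sum, Finset.sum_mul]
  simp_rw [Finset.sum_comm (t := (Finset.univ : Finset (Fin r)))]
  refine Finset.sum_congr rfl fun i _ => ?_
  rw [Finset.sum_comm]
  exact Finset.sum_congr rfl fun q _ => Finset.sum_congr rfl fun p _ => by ring

theorem tensorSlice_tensorTransform {R : Type*} [CommSemiring R] {s : ℕ}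
    (E : Matrix (Fin b) (Fin r) R) (F : Matrix (Fin c) (Fin s) R)
    (S : Fin a × Fin r × Fin s → R) (i : Fin a) :
    tensorSlice (tensorTransform E F S) i = E * tensorSlice S i * F.transpose := by
  ext j k
  simp only [tensorSlice, tensorTransform, Matrix.mul_apply, Matrix.of_apply,
    Matrix.transpose_apply, Finset.sum_mul]
  rw [Finset.sum_comm]
  exact Finset.sum_congr rfl fun q _ => Finset.sum_congr rfl fun p _ => by ring

theorem subspaceVariety_subset_secantCone [CharZero K] :
    subspaceVariety K 2 b c r ⊆ secantCone K 2 b c r := by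
  rintro T ⟨B', C', hB, hC, hB', hC'⟩ f hf
  rw [mem_secantIdeal_iff] at hf
  obtain ⟨E, E', hE⟩ := B'.exists_mul_mulVec_eq_self hB
  obtain ⟨F, F', hF⟩ := C'.exists_mul_mulVec_eq_self hC
  have hT : T = tensorTransform E F (tensorTransform E' F' T) := by
    have hslice : ∀ i, tensorSlice T i =
        tensorSlice (tensorTransform E F (tensorTransform E' F' T)) i := fun i => by
      have h1 : E * (E' * tensorSlice T i) = tensorSlice T i := by
        ext j k
        exact congrFun (hE _ (hB' i k)) j
      have h2 : F * (F' * (tensorSlice T i).transpose) = (tensorSlice T i).transpose := by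
        ext k j
        exact congrFun (hF _ (hC' i j)) k
      have h3 := congrArg Matrix.transpose h2
      simp only [Matrix.transpose_mul, Matrix.transpose_transpose] at h3
      rw [tensorSlice_tensorTransform, tensorSlice_tensorTransform, ← Matrix.mul_assoc,
        ← Matrix.mul_assoc, Matrix.mul_assoc E, h1, h3]
    ext ⟨i, j, k⟩
    exact congrFun (congrFun (hslice i) j) k
  have hφ : ∀ S : Fin 2 × Fin r × Fin r → K, MvPolynomial.eval S (MvPolynomial.bind₁
      (tensorTransform (E.map C) (F.map C) X) f) = MvPolynomial.eval (tensorTransform E F S) f := by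
    intro S
    rw [← MvPolynomial.aeval_eq_eval, MvPolynomial.aeval_bind₁, MvPolynomial.aeval_eq_eval]
    congr 2
    ext x
    simp [tensorTransform]
  rw [hT, ← hφ, eq_zero_of_eval_rankLE_eq_zero (MvPolynomial.bind₁ _ f), map_zero]
  intro S hS
  rw [hφ]
  exact hf _ (hS.tensorTransform E F)

end Secant

/-- **Theorem (Strassen; Landsberg–Weyman, proof of Theorem 1.2).**  For `dim A = 2`
and `b, c ≥ r`, `σ_r(PA* × PB* × PC*) = P(Sub_{2,r,r})`.  In particular, when
`b = c = r`, `σ_r(P¹ × P^{r-1} × P^{r-1}) = P(K² ⊗ K^r ⊗ K^r)`: the Zariski closure of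
the tensors of rank at most `r` is everything. -/
theorem sigma_r_eq_subspaceVariety (K : Type) [Field K] [CharZero K] (b c r : ℕ)
    (hr : 1 ≤ r) (hb : r ≤ b) (hc : r ≤ c) :
    secantCone K 2 b c r = subspaceVariety K 2 b c r ∧
    (b = r → c = r → secantCone K 2 b c r = Set.univ) := by
  have h : secantCone K 2 b c r = subspaceVariety K 2 b c r :=
    (secantCone_subset_subspaceVariety hb hc).antisymm subspaceVariety_subset_secantCone
  refine ⟨h, fun hbr hcr => ?_⟩
  rw [h]
  exact Set.eq_univ_of_forall fun T => ⟨⊤, ⊤, by simp [hbr], by simp [hcr], by simp, by simp⟩
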